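/- Let a < b be real numbers, let n ≥ 1 be an integer, and consider the uniform partition xᵢ = a + i(b−a)/n (i = 0, 1, …, n) of [a,b] with mesh h = (b−a)/n. Let f : [a,b] → ℝ be absolutely continuous on [a,b] with f' ∈ L²[a,b], and set σ(f') = ‖f'‖₂² − (f(b) − f(a))²/(b − a). Define S(f, Iₙ) = (h/2) ∑_{i=0}^{n−1} [f((3xᵢ + x_{i+1})/4) + f((xᵢ + 3x_{i+1})/4)]. Then |∫_a^b f(x) dx − S(f, Iₙ)| ≤ ((b−a)^{3/2}/(4√3 n)) · √(σ(f')). -/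

import Mathlib

open MeasureTheory Set

/-- Cauchy–Schwarz against `t - p` on an interval with endpoints `p`, `q` in either order. -/
lemma sq_integral_sub_mul_le {p q : ℝ} {g : ℝ → ℝ}
    (hg : IntervalIntegrable g volume p q)
    (hg2 : IntervalIntegrable (fun t => g t ^ 2) volume p q) :
    (∫ t in p..q, (t - p) * g t) ^ 2 ≤ (q - p) ^ 3 / 3 * ∫ t in p..q, g t ^ 2 := by
  rcases eq_or_ne p q with rfl | hpq
  · simp
  set A := ∫ t in p..q, (t - p) * g t with hA
  set Q := ∫ t in p..q, g t ^ 2 with hQ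
  set v := q - p with hv
  have hlin : IntervalIntegrable (fun t => (t - p) * g t) volume p q :=
    hg.continuousOn_mul (by fun_prop)
  have hsq : IntervalIntegrable (fun t => (t - p) ^ 2) volume p q :=
    Continuous.intervalIntegrable (by fun_prop) _ _
  have hsq_val : ∫ t in p..q, (t - p) ^ 2 = v ^ 3 / 3 := by
    rw [intervalIntegral.integral_comp_sub_right (fun t => t ^ 2) p, integral_pow]
    norm_num [hv]
  have hexpand (r s : ℝ) : ∫ t in p..q, (r * g t - s * (t - p)) ^ 2
      = r ^ 2 * Q - 2 * r * s * A + s ^ 2 * (v ^ 3 / 3) := by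
    rw [← hsq_val, hQ, hA, ← intervalIntegral.integral_const_mul,
      ← intervalIntegral.integral_const_mul, ← intervalIntegral.integral_const_mul,
      ← intervalIntegral.integral_sub (hg2.const_mul _) (hlin.const_mul _),
      ← intervalIntegral.integral_add ((hg2.const_mul _).sub (hlin.const_mul _))
        (hsq.const_mul _)]
    congr 1
    ext t
    ring
  have hnonneg : 0 ≤ v * ∫ t in p..q, (v ^ 3 / 3 * g t - A * (t - p)) ^ 2 := by
    rcases le_total p q with h | h
    · exact mul_nonneg (sub_nonneg.2 h)
        (intervalIntegral.integral_nonneg h fun _ _ => sq_nonneg _)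
    · rw [intervalIntegral.integral_symm]
      exact mul_nonneg_of_nonpos_of_nonpos (sub_nonpos.2 h)
        (neg_nonpos.2 (intervalIntegral.integral_nonneg h fun _ _ => sq_nonneg _))
  have hv4 : 0 < v ^ 4 / 3 := by
    have : v ≠ 0 := sub_ne_zero.2 hpq.symm
    positivity
  rw [hexpand] at hnonneg
  have : 0 ≤ v ^ 4 / 3 * (v ^ 3 / 3 * Q - A ^ 2) := by linarith
  linarith [nonneg_of_mul_nonneg_right this hv4]

/-- Integration by parts for the error of the one-point rule at the endpoint `q`. -/
lemma integral_sub_mul_endpoint_eq {p q : ℝ} {f g : ℝ → ℝ}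
    (hg : IntervalIntegrable g volume p q)
    (hf : ∀ y ∈ uIcc p q, f y - f p = ∫ t in p..y, g t) :
    (∫ t in p..q, f t) - (q - p) * f q = -∫ t in p..q, (t - p) * g t := by
  have hu : AbsolutelyContinuousOnInterval (fun t : ℝ => t - p) p q :=
    ContDiffOn.absolutelyContinuousOnInterval (by fun_prop)
  have hw := hg.absolutelyContinuousOnInterval_intervalIntegral (c := p) left_mem_uIcc
  have hparts := hu.integral_mul_deriv_eq_deriv_mul hw
  have hderiv : ∫ t in p..q, (t - p) * deriv (fun x => ∫ s in p..x, g s) t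
      = ∫ t in p..q, (t - p) * g t := by
    apply intervalIntegral.integral_congr_ae
    filter_upwards [hg.ae_hasDerivAt_integral] with t ht htm
    rw [(ht (uIoc_subset_uIcc htm) p left_mem_uIcc).deriv]
  have hfint : ∫ t in p..q, f t = (q - p) * f p + ∫ t in p..q, ∫ s in p..t, g s := by
    rw [← smul_eq_mul, ← intervalIntegral.integral_const,
      ← intervalIntegral.integral_add intervalIntegrable_const hw.continuousOn.intervalIntegrable]
    apply intervalIntegral.integral_congr
    intro t ht
    linarith [hf t ht]
  have hone : ∀ t : ℝ, deriv (fun t : ℝ => t - p) t = 1 := fun t => by simp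
  simp only [hone, one_mul, sub_self, zero_mul, sub_zero] at hparts
  rw [hderiv, ← hf q right_mem_uIcc] at hparts
  rw [hparts, hfint]
  ring

lemma sq_integral_sub_mul_endpoint_le {p q : ℝ} {f g : ℝ → ℝ}
    (hg : IntervalIntegrable g volume p q)
    (hg2 : IntervalIntegrable (fun t => g t ^ 2) volume p q)
    (hf : ∀ y ∈ uIcc p q, f y - f p = ∫ t in p..y, g t) :
    ((∫ t in p..q, f t) - (q - p) * f q) ^ 2 ≤ (q - p) ^ 3 / 3 * ∫ t in p..q, g t ^ 2 := by
  rw [integral_sub_mul_endpoint_eq hg hf, neg_sq]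
  exact sq_integral_sub_mul_le hg hg2

/-- Error of the midpoint rule on `[c, d]` in terms of the `L²` norm of the derivative. -/
lemma sq_midpoint_error_le {c d : ℝ} (hcd : c ≤ d) {f g : ℝ → ℝ}
    (hcont : ContinuousOn f (Icc c d))
    (hg : IntervalIntegrable g volume c d)
    (hg2 : IntervalIntegrable (fun t => g t ^ 2) volume c d)
    (hf : ∀ x ∈ Icc c d, ∀ y ∈ Icc c d, f y - f x = ∫ t in x..y, g t) :
    ((∫ t in c..d, f t) - (d - c) * f ((c + d) / 2)) ^ 2
      ≤ (d - c) ^ 3 / 12 * ∫ t in c..d, g t ^ 2 := by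
  set m := (c + d) / 2 with hm
  have hcm : c ≤ m := by linarith
  have hmd : m ≤ d := by linarith
  have hleft : uIcc c m ⊆ Icc c d := uIcc_of_le hcm ▸ Icc_subset_Icc_right hmd
  have hright : uIcc d m ⊆ Icc c d := uIcc_of_ge hmd ▸ Icc_subset_Icc_left hcm
  have hcd' : Icc c d = uIcc c d := (uIcc_of_le hcd).symm
  have hL := sq_integral_sub_mul_endpoint_le (f := f) (hg.mono_set (hcd' ▸ hleft))
    (hg2.mono_set (hcd' ▸ hleft)) fun y hy => hf c ⟨le_rfl, hcd⟩ y (hleft hy)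
  have hR := sq_integral_sub_mul_endpoint_le (f := f) (hg.mono_set (hcd' ▸ hright))
    (hg2.mono_set (hcd' ▸ hright)) fun y hy => hf d ⟨hcd, le_rfl⟩ y (hright hy)
  have hfsplit := intervalIntegral.integral_add_adjacent_intervals
    (hcont.mono hleft).intervalIntegrable (hcont.mono hright).intervalIntegrable.symm
    (μ := volume)
  have hgsplit := intervalIntegral.integral_add_adjacent_intervals
    (hg2.mono_set (hcd' ▸ hleft)) (hg2.mono_set (hcd' ▸ hright)).symm
  rw [intervalIntegral.integral_symm m d] at hR
  rw [intervalIntegral.integral_symm m d (f := fun t => g t ^ 2)] at hR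
  rw [← hfsplit, ← hgsplit]
  have h1 : m - c = (d - c) / 2 := by rw [hm]; ring
  have h2 : m - d = -((d - c) / 2) := by rw [hm]; ring
  rw [h1] at hL
  rw [h2] at hR
  nlinarith [sq_nonneg (((∫ t in c..m, f t) - (d - c) / 2 * f m)
    - ((∫ t in m..d, f t) - (d - c) / 2 * f m))]

/-- Error of the two-point rule obtained by applying the midpoint rule on both halves of
`[c, d]`. -/
lemma sq_two_point_error_le {c d : ℝ} (hcd : c ≤ d) {f g : ℝ → ℝ}
    (hcont : ContinuousOn f (Icc c d))
    (hg : IntervalIntegrable g volume c d)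
    (hg2 : IntervalIntegrable (fun t => g t ^ 2) volume c d)
    (hf : ∀ x ∈ Icc c d, ∀ y ∈ Icc c d, f y - f x = ∫ t in x..y, g t) :
    ((∫ t in c..d, f t) - (d - c) / 2 * (f ((3 * c + d) / 4) + f ((c + 3 * d) / 4))) ^ 2
      ≤ (d - c) ^ 3 / 48 * ∫ t in c..d, g t ^ 2 := by
  set m := (c + d) / 2 with hm
  have hcm : c ≤ m := by linarith
  have hmd : m ≤ d := by linarith
  have hleft : Icc c m ⊆ Icc c d := Icc_subset_Icc_right hmd
  have hright : Icc m d ⊆ Icc c d := Icc_subset_Icc_left hcm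
  have hleft' : uIcc c m ⊆ uIcc c d := by rwa [uIcc_of_le hcm, uIcc_of_le hcd]
  have hright' : uIcc m d ⊆ uIcc c d := by rwa [uIcc_of_le hmd, uIcc_of_le hcd]
  have hL := sq_midpoint_error_le hcm (hcont.mono hleft) (hg.mono_set hleft')
    (hg2.mono_set hleft') fun x hx y hy => hf x (hleft hx) y (hleft hy)
  have hR := sq_midpoint_error_le hmd (hcont.mono hright) (hg.mono_set hright')
    (hg2.mono_set hright') fun x hx y hy => hf x (hright hx) y (hright hy)
  rw [← intervalIntegral.integral_add_adjacent_intervals (b := m)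
      ((hcont.mono hleft).intervalIntegrable_of_Icc hcm)
      ((hcont.mono hright).intervalIntegrable_of_Icc hmd),
    ← intervalIntegral.integral_add_adjacent_intervals (b := m)
      (hg2.mono_set hleft') (hg2.mono_set hright')]
  have h1 : m - c = (d - c) / 2 := by rw [hm]; ring
  have h2 : d - m = (d - c) / 2 := by rw [hm]; ring
  have h3 : (c + m) / 2 = (3 * c + d) / 4 := by rw [hm]; ring
  have h4 : (m + d) / 2 = (c + 3 * d) / 4 := by rw [hm]; ring
  rw [h1, h3] at hL
  rw [h2, h4] at hR
  nlinarith [sq_nonneg (((∫ t in c..m, f t) - (d - c) / 2 * f ((3 * c + d) / 4))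
    - ((∫ t in m..d, f t) - (d - c) / 2 * f ((c + 3 * d) / 4)))]

/-- Error of the composite two-point rule in terms of the `L²` norm of the derivative. -/
lemma sq_composite_two_point_error_le {a b : ℝ} (hab : a ≤ b) {n : ℕ} (hn : n ≠ 0)
    {x : ℕ → ℝ} (hx : ∀ i, x i = a + i * (b - a) / n) {f g : ℝ → ℝ}
    (hcont : ContinuousOn f (Icc a b))
    (hg : IntervalIntegrable g volume a b)
    (hg2 : IntervalIntegrable (fun t => g t ^ 2) volume a b)
    (hf : ∀ x ∈ Icc a b, ∀ y ∈ Icc a b, f y - f x = ∫ t in x..y, g t) :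
    ((∫ t in a..b, f t) - (b - a) / n / 2 * ∑ i ∈ Finset.range n,
        (f ((3 * x i + x (i + 1)) / 4) + f ((x i + 3 * x (i + 1)) / 4))) ^ 2
      ≤ (b - a) ^ 3 / (48 * n ^ 2) * ∫ t in a..b, g t ^ 2 := by
  have hn0 : (n : ℝ) ≠ 0 := Nat.cast_ne_zero.2 hn
  have hx0 : x 0 = a := by simp [hx]
  have hxn : x n = b := by rw [hx]; field_simp; ring
  have hstep : ∀ i, x (i + 1) - x i = (b - a) / n := fun i => by
    rw [hx, hx]; push_cast; ring
  have hmono : Monotone x := monotone_nat_of_le_succ fun i => by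
    have : 0 ≤ (b - a) / n := div_nonneg (sub_nonneg.2 hab) n.cast_nonneg
    linarith [hstep i]
  have hsub : ∀ i < n, Icc (x i) (x (i + 1)) ⊆ Icc a b := fun i hi => by
    rw [← hx0, ← hxn]
    exact Icc_subset_Icc (hmono i.zero_le) (hmono hi)
  have hsub' : ∀ i < n, uIcc (x i) (x (i + 1)) ⊆ uIcc a b := fun i hi => by
    rw [uIcc_of_le (hmono i.le_succ), uIcc_of_le hab]
    exact hsub i hi
  have hfsum := intervalIntegral.sum_integral_adjacent_intervals (μ := volume) (f := f) (a := x)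
    (n := n) fun i hi => (hcont.intervalIntegrable_of_Icc hab).mono_set (hsub' i hi)
  have hgsum := intervalIntegral.sum_integral_adjacent_intervals (a := x)
    (n := n) fun i hi => hg2.mono_set (hsub' i hi)
  rw [hx0, hxn] at hfsum hgsum
  rw [← hfsum, ← hgsum, Finset.mul_sum, ← Finset.sum_sub_distrib]
  refine sq_sum_le_card_mul_sum_sq.trans ?_
  have hlocal : ∀ i ∈ Finset.range n, ((∫ t in x i..x (i + 1), f t) - (b - a) / n / 2 *
      (f ((3 * x i + x (i + 1)) / 4) + f ((x i + 3 * x (i + 1)) / 4))) ^ 2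
      ≤ ((b - a) / n) ^ 3 / 48 * ∫ t in x i..x (i + 1), g t ^ 2 := fun i hi => by
    have hi := Finset.mem_range.1 hi
    rw [← hstep i]
    exact sq_two_point_error_le (hmono i.le_succ) (hcont.mono (hsub i hi))
      (hg.mono_set (hsub' i hi)) (hg2.mono_set (hsub' i hi))
      fun y hy z hz => hf y (hsub i hi hy) z (hsub i hi hz)
  calc _ ≤ (n : ℝ) * ∑ i ∈ Finset.range n,
        ((b - a) / n) ^ 3 / 48 * ∫ t in x i..x (i + 1), g t ^ 2 := by
        rw [Finset.card_range]
        gcongr with i hi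
        exact hlocal i hi
    _ = _ := by
        rw [← Finset.mul_sum]
        field_simp


/-- **Composite quadrature rule for `f' ∈ L²[a,b]`, uniform partition** (Theorem 3.3,
inequality (3.5)). With nodes `x i = a + i (b-a)/n` and mesh `h = (b-a)/n`, for `f`
absolutely continuous on `[a,b]` (encoded by continuity and the FTC identity) with `f'`
square-integrable, and `σ(f') = ∫_a^b f'(t)² dt - (f b - f a)²/(b - a)`, the composite rule
`S(f, Iₙ) = (h/2) ∑ᵢ [f((3xᵢ+x_{i+1})/4) + f((xᵢ+3x_{i+1})/4)]` satisfies
`|∫_a^b f - S(f, Iₙ)| ≤ ((b-a)^{3/2}/(4√3 n)) √(σ(f'))`. -/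
theorem composite_quadrature_first_deriv_L2
    (a b : ℝ) (hab : a < b) (n : ℕ) (hn : 1 ≤ n)
    (x : ℕ → ℝ) (hx : ∀ i, x i = a + i * (b - a) / n)
    (f f' : ℝ → ℝ)
    (hcont : ContinuousOn f (Set.Icc a b))
    (hint : IntervalIntegrable f' MeasureTheory.volume a b)
    (hftc : ∀ y ∈ Set.Icc a b, f y - f a = ∫ t in a..y, f' t)
    (hL2 : IntervalIntegrable (fun t => (f' t) ^ 2) MeasureTheory.volume a b)
    (σ : ℝ) (hσ : σ = (∫ t in a..b, (f' t) ^ 2) - (f b - f a) ^ 2 / (b - a)) :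
    |(∫ t in a..b, f t) -
        ((b - a) / n / 2) * ∑ i ∈ Finset.range n,
          (f ((3 * x i + x (i + 1)) / 4) + f ((x i + 3 * x (i + 1)) / 4))|
      ≤ (b - a) ^ ((3 : ℝ) / 2) / (4 * Real.sqrt 3 * n) * Real.sqrt σ := by
  have hba : 0 < b - a := sub_pos.2 hab
  have hn0 : (n : ℝ) ≠ 0 := Nat.cast_ne_zero.2 (by omega)
  set k := (f b - f a) / (b - a) with hk
  have hmem : ∀ y ∈ Icc a b, IntervalIntegrable f' volume a y := fun y hy =>
    hint.mono_set (by rw [uIcc_of_le hy.1, uIcc_of_le hab.le]; exact Icc_subset_Icc_right hy.2)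
  have hexpand : ∀ t, (f' t - k) ^ 2 = f' t ^ 2 - 2 * k * f' t + k ^ 2 := fun t => by ring
  have hg2 : IntervalIntegrable (fun t => (f' t - k) ^ 2) volume a b := by
    simp only [hexpand]
    exact (hL2.sub (hint.const_mul _)).add intervalIntegrable_const
  have hσ' : ∫ t in a..b, (f' t - k) ^ 2 = σ := by
    simp only [hexpand]
    rw [intervalIntegral.integral_add (hL2.sub (hint.const_mul _)) intervalIntegrable_const,
      intervalIntegral.integral_sub hL2 (hint.const_mul _), intervalIntegral.integral_const_mul,
      intervalIntegral.integral_const, ← hftc b ⟨hab.le, le_rfl⟩, hσ, hk, smul_eq_mul]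
    field_simp
    ring
  have herr := sq_composite_two_point_error_le hab.le (by omega : n ≠ 0) hx
    (f := fun t => f t - k * (t - (a + b) / 2)) (g := fun t => f' t - k)
    (hcont.sub (by fun_prop)) (hint.sub intervalIntegrable_const) hg2 fun y hy z hz => by
      rw [intervalIntegral.integral_sub ((hmem y hy).symm.trans (hmem z hz))
        intervalIntegrable_const, intervalIntegral.integral_const,
        ← intervalIntegral.integral_interval_sub_left (hmem z hz) (hmem y hy),
        ← hftc y hy, ← hftc z hz, smul_eq_mul]
      ring
  have hlin : ∫ t in a..b, k * (t - (a + b) / 2) = 0 := by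
    rw [intervalIntegral.integral_const_mul, intervalIntegral.integral_sub
      (Continuous.intervalIntegrable (by fun_prop) _ _) intervalIntegrable_const, integral_id,
      intervalIntegral.integral_const, smul_eq_mul]
    ring
  have hsum : ∑ i ∈ Finset.range n, (k * ((3 * x i + x (i + 1)) / 4 - (a + b) / 2)
      + k * ((x i + 3 * x (i + 1)) / 4 - (a + b) / 2)) = 0 := by
    have hpartial : ∀ m : ℕ, ∑ i ∈ Finset.range m,
        (k * ((3 * x i + x (i + 1)) / 4 - (a + b) / 2)
          + k * ((x i + 3 * x (i + 1)) / 4 - (a + b) / 2))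
        = k * (b - a) * m * (m / n - 1) := fun m => by
      induction m with
      | zero => simp
      | succ m ih =>
        rw [Finset.sum_range_succ, ih, hx, hx]
        push_cast
        field_simp
        ring
    rw [hpartial, div_self hn0]
    ring
  have hsplit : ∀ i, (f ((3 * x i + x (i + 1)) / 4) - k * ((3 * x i + x (i + 1)) / 4 - (a + b) / 2)
      + (f ((x i + 3 * x (i + 1)) / 4) - k * ((x i + 3 * x (i + 1)) / 4 - (a + b) / 2)))
      = (f ((3 * x i + x (i + 1)) / 4) + f ((x i + 3 * x (i + 1)) / 4))
        - (k * ((3 * x i + x (i + 1)) / 4 - (a + b) / 2)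
          + k * ((x i + 3 * x (i + 1)) / 4 - (a + b) / 2)) := fun i => by ring
  rw [hσ', intervalIntegral.integral_sub (hcont.intervalIntegrable_of_Icc hab.le)
    (Continuous.intervalIntegrable (by fun_prop) _ _), hlin, sub_zero] at herr
  simp only [hsplit] at herr
  rw [Finset.sum_sub_distrib, hsum, sub_zero] at herr
  refine (Real.abs_le_sqrt herr).trans_eq ?_
  rw [Real.sqrt_mul (by positivity)]
  congr 1
  have hpow : ((b - a) ^ ((3 : ℝ) / 2)) ^ 2 = (b - a) ^ 3 := by
    rw [← Real.rpow_mul_natCast hba.le, ← Real.rpow_natCast]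
    norm_num
  rw [Real.sqrt_eq_iff_mul_self_eq (by positivity) (by positivity), ← sq, div_pow, mul_pow, mul_pow,
    Real.sq_sqrt (by norm_num), hpow]
  norm_num
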